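/- arXiv:math/0309112 — 3 statements merged into one kernel-verified Lean document; each statement's English description precedes it below -/
import Mathlib

section
/- Let m ≥ 1, let B : [0,∞) → M_m(ℂ) be continuous with B(t) Hermitian for every t, let f : [0,∞) → ℂ^m be continuous with ∫₀^∞ |f(s)| ds < ∞, and let a : [0,∞) → ℂ^m be differentiable with a′(t) = −i (B(t) a(t) + f(t)) for all t ≥ 0 and a(t) → 0 as t → +∞. Then |a(t)| ≤ ∫_t^∞ |f(s)| ds for all t ≥ 0. Consequently, if |f(s)| ≤ K e^{−αs} for some K ≥ 0 and α > 0, then |a(t)| ≤ (K/α) e^{−αt} for all t ≥ 0. -/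
open MeasureTheory Filter
open scoped ENNReal

noncomputable section

/-- Energy estimate: the real part of `⟨a, -i(Ba+f)⟩` is at least `-|a||f|`. -/
theorem energy_aux {m : ℕ} (B : Matrix (Fin m) (Fin m) ℂ) (hB : B.IsHermitian)
    (a f : EuclideanSpace ℂ (Fin m)) :
    -(‖a‖ * ‖f‖) ≤ (inner ℂ a ((-Complex.I) • (Matrix.toEuclideanLin B a + f))).re := by
  have h1 : (inner ℂ a (Matrix.toEuclideanLin B a)).im = 0 := by
    have hs := Matrix.isSymmetric_toEuclideanLin_iff.2 hB
    have h2 := hs.conj_inner_sym a a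
    have h3 := hs a a
    rw [h3] at h2
    exact Complex.conj_eq_iff_im.1 h2
  have h2 : ‖inner ℂ a f‖ ≤ ‖a‖ * ‖f‖ := norm_inner_le_norm a f
  have h3 := Complex.abs_im_le_norm (inner ℂ a f)
  have h4 := abs_le.1 (h3.trans h2)
  rw [inner_smul_right, inner_add_right]
  simp only [Complex.mul_re, Complex.neg_re, Complex.neg_im, Complex.I_re, Complex.I_im,
    Complex.add_re, Complex.add_im, h1]
  linarith [h4.1]

theorem bound_aux {m : ℕ}
    (B : ℝ → Matrix (Fin m) (Fin m) ℂ)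
    (hBherm : ∀ t : ℝ, 0 ≤ t → (B t).IsHermitian)
    (f : ℝ → EuclideanSpace ℂ (Fin m)) (a : ℝ → EuclideanSpace ℂ (Fin m))
    (hfint : IntegrableOn (fun s => ‖f s‖) (Set.Ici (0 : ℝ)) volume)
    (ha : ∀ t : ℝ, 0 ≤ t → HasDerivWithinAt a
      ((-Complex.I) • (Matrix.toEuclideanLin (B t) (a t) + f t)) (Set.Ici (0 : ℝ)) t)
    (ha0 : Tendsto a atTop (nhds 0)) (t : ℝ) (ht : 0 ≤ t) :
    ‖a t‖ ≤ ∫ s in Set.Ici t, ‖f s‖ := by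
  have hft : IntegrableOn (fun s => ‖f s‖) (Set.Ici t) volume :=
    hfint.mono_set (Set.Ici_subset_Ici.2 ht)
  have hac : ContinuousOn a (Set.Ici 0) := fun x hx => (ha x hx).continuousWithinAt
  refine le_of_forall_pos_le_add fun ε hε => ?_
  have key : ∀ T, t ≤ T →
      ‖a t‖ ≤ Real.sqrt (‖a T‖ ^ 2 + ε ^ 2) + ∫ s in Set.Ici t, ‖f s‖ := by
    intro T hT
    have hsub : Set.Icc t T ⊆ Set.Ici t := fun x hx => hx.1
    have h := intervalIntegral.sub_le_integral_of_hasDeriv_right_of_le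
      (g := fun x => -Real.sqrt (‖a x‖ ^ 2 + ε ^ 2))
      (g' := fun x => -((2 * (inner ℂ (a x)
        ((-Complex.I) • (Matrix.toEuclideanLin (B x) (a x) + f x))).re) /
          (2 * Real.sqrt (‖a x‖ ^ 2 + ε ^ 2))))
      (φ := fun s => ‖f s‖) hT ?_ ?_ (hft.mono_set hsub) ?_
    · rw [intervalIntegral.integral_of_le hT] at h
      have h2 : ∫ s in Set.Ioc t T, ‖f s‖ ≤ ∫ s in Set.Ici t, ‖f s‖ :=
        setIntegral_mono_set hft (Eventually.of_forall fun _ => norm_nonneg _)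
          (Set.Ioc_subset_Icc_self.trans hsub).eventuallyLE
      have h3 : ‖a t‖ ≤ Real.sqrt (‖a t‖ ^ 2 + ε ^ 2) :=
        Real.le_sqrt_of_sq_le (by nlinarith)
      linarith
    · have : ContinuousOn a (Set.Icc t T) := hac.mono fun x hx => ht.trans hx.1
      fun_prop
    · intro x hx
      have hx0 : 0 < x := ht.trans_lt hx.1
      have hd := (ha x hx0.le).hasDerivAt (Ici_mem_nhds hx0)
      have hi := hd.inner ℂ hd
      have hr := (Complex.reCLM.hasFDerivAt.comp_hasDerivAt x hi).add_const (ε ^ 2)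
      have hsq : HasDerivAt (fun y => ‖a y‖ ^ 2 + ε ^ 2) (2 * (inner ℂ (a x)
        ((-Complex.I) • (Matrix.toEuclideanLin (B x) (a x) + f x))).re) x := by
        refine (hr.congr_deriv ?_).congr_of_eventuallyEq (Eventually.of_forall fun y => ?_)
        · have := inner_re_symm (𝕜 := ℂ) (a x)
            ((-Complex.I) • (Matrix.toEuclideanLin (B x) (a x) + f x))
          simp only [RCLike.re_eq_complex_re] at this
          rw [Complex.reCLM_apply, Complex.add_re, ← this]
          ring
        · have := inner_self_eq_norm_sq (𝕜 := ℂ) (a y)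
          simp only [RCLike.re_eq_complex_re] at this
          simp only [Function.comp_apply, Complex.reCLM_apply, this]
      exact ((hsq.sqrt (by positivity)).neg).hasDerivWithinAt
    · intro x hx
      have hx0 : 0 < x := ht.trans_lt hx.1
      have he := energy_aux (B x) (hBherm x hx0.le) (a x) (f x)
      have hpos : 0 < Real.sqrt (‖a x‖ ^ 2 + ε ^ 2) := Real.sqrt_pos.2 (by positivity)
      have h3 : ‖a x‖ ≤ Real.sqrt (‖a x‖ ^ 2 + ε ^ 2) :=
        Real.le_sqrt_of_sq_le (by nlinarith)
      have h4 := mul_le_mul_of_nonneg_right h3 (norm_nonneg (f x))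
      rw [← neg_div, div_le_iff₀ (by positivity)]
      linarith
  have hlim : Tendsto (fun T => Real.sqrt (‖a T‖ ^ 2 + ε ^ 2) + ∫ s in Set.Ici t, ‖f s‖) atTop
      (nhds (Real.sqrt (‖(0 : EuclideanSpace ℂ (Fin m))‖ ^ 2 + ε ^ 2)
        + ∫ s in Set.Ici t, ‖f s‖)) :=
    (((ha0.norm.pow 2).add_const _).sqrt).add_const _
  have := ge_of_tendsto hlim ((eventually_ge_atTop t).mono key)
  simp only [norm_zero] at this
  rw [show (0 : ℝ) ^ 2 + ε ^ 2 = ε ^ 2 by ring, Real.sqrt_sq hε.le] at this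
  linarith

/-- a linear ODE `a′(t) = −i(B(t)a(t) + f(t))` with Hermitian continuous
matrix coefficient `B`, integrable continuous inhomogeneity `f`, and `a(t) → 0` as
`t → ∞`, satisfies `|a(t)| ≤ ∫_t^∞ |f(s)| ds`; consequently an exponential bound
`|f(s)| ≤ K e^{−αs}` yields `|a(t)| ≤ (K/α) e^{−αt}`. -/
theorem stmt_1 (m : ℕ) (hm : 1 ≤ m)
    (B : ℝ → Matrix (Fin m) (Fin m) ℂ)
    (hBcont : ContinuousOn B (Set.Ici (0 : ℝ)))
    (hBherm : ∀ t : ℝ, 0 ≤ t → (B t).IsHermitian)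
    (f : ℝ → EuclideanSpace ℂ (Fin m)) (a : ℝ → EuclideanSpace ℂ (Fin m))
    (hfcont : ContinuousOn f (Set.Ici (0 : ℝ)))
    (hfint : IntegrableOn (fun s => ‖f s‖) (Set.Ici (0 : ℝ)) volume)
    (ha : ∀ t : ℝ, 0 ≤ t → HasDerivWithinAt a
      ((-Complex.I) • (Matrix.toEuclideanLin (B t) (a t) + f t)) (Set.Ici (0 : ℝ)) t)
    (ha0 : Tendsto a atTop (nhds 0)) :
    (∀ t : ℝ, 0 ≤ t → ‖a t‖ ≤ ∫ s in Set.Ici t, ‖f s‖) ∧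
    ∀ K α : ℝ, 0 ≤ K → 0 < α → (∀ s : ℝ, 0 ≤ s → ‖f s‖ ≤ K * Real.exp (-α * s)) →
      ∀ t : ℝ, 0 ≤ t → ‖a t‖ ≤ (K / α) * Real.exp (-α * t) := by
  have h1 := bound_aux B hBherm f a hfint ha ha0
  refine ⟨h1, fun K α hK hα hf t ht => (h1 t ht).trans ?_⟩
  have hi : IntegrableOn (fun s => K * Real.exp (-α * s)) (Set.Ioi t) :=
    (integrableOn_exp_mul_Ioi (neg_lt_zero.2 hα) t).const_mul K
  rw [integral_Ici_eq_integral_Ioi]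
  have h2 : ∫ s in Set.Ioi t, ‖f s‖ ≤ ∫ s in Set.Ioi t, K * Real.exp (-α * s) :=
    setIntegral_mono_on (hfint.mono_set fun x hx => ht.trans (le_of_lt hx)) hi
      measurableSet_Ioi fun x hx => hf x (ht.trans (le_of_lt hx))
  refine h2.trans_eq ?_
  rw [integral_const_mul, integral_exp_mul_Ioi (neg_lt_zero.2 hα)]
  field_simp
end
end

section
/- Let n ≥ 1, s ∈ ℝ, let f be a Schwartz function on ℝⁿ, let v ∈ L¹(ℝⁿ), and define V(x) := (2π)^{−n/2} ∫ v(ξ) e^{i x·ξ} dξ (so V is bounded and continuous). Then e^{isΔ/2}(V · (e^{−isΔ/2} f))(x) = (2π)^{−n/2} ∫ v(ξ) e^{i x·ξ − i s|ξ|²/2} f(x − sξ) dξ for every x ∈ ℝⁿ, and consequently, for every 1 ≤ p ≤ ∞, ‖e^{isΔ/2}(V · (e^{−isΔ/2} f))‖_{L^p} ≤ (2π)^{−n/2} ‖v‖_{L¹} ‖f‖_{L^p}. -/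
open MeasureTheory Filter
open scoped ENNReal RealInnerProductSpace

noncomputable section

/-- The Fourier transform `ℱf(ξ) = (2π)^{−n/2} ∫ f(x) e^{−i x·ξ} dx`. -/
def FT {n : ℕ} (f : EuclideanSpace ℝ (Fin n) → ℂ) (ξ : EuclideanSpace ℝ (Fin n)) : ℂ :=
  (((2 * Real.pi) ^ (-(n : ℝ) / 2) : ℝ) : ℂ) *
    ∫ x, f x * Complex.exp (-Complex.I * ((⟪x, ξ⟫ : ℝ) : ℂ))

/-- The inverse Fourier transform. -/
def IFT {n : ℕ} (g : EuclideanSpace ℝ (Fin n) → ℂ) (x : EuclideanSpace ℝ (Fin n)) : ℂ :=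
  (((2 * Real.pi) ^ (-(n : ℝ) / 2) : ℝ) : ℂ) *
    ∫ ξ, g ξ * Complex.exp (Complex.I * ((⟪x, ξ⟫ : ℝ) : ℂ))

/-- The free Schrödinger propagator `e^{itΔ/2}`, the Fourier multiplier with symbol
`e^{−it|ξ|²/2}`. -/
def freeProp {n : ℕ} (t : ℝ) (g : EuclideanSpace ℝ (Fin n) → ℂ) :
    EuclideanSpace ℝ (Fin n) → ℂ :=
  IFT (fun ξ => Complex.exp (-Complex.I * (t : ℂ) * (‖ξ‖ : ℂ) ^ 2 / 2) * FT g ξ)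

open scoped FourierTransform SchwartzMap

abbrev EE (n : ℕ) := EuclideanSpace ℝ (Fin n)

/-- The normalising constant. -/
def cc (n : ℕ) : ℝ := (2 * Real.pi) ^ (-(n : ℝ) / 2)

lemma cc_pos (n : ℕ) : 0 < cc n := by unfold cc; positivity

lemma cc_sq (n : ℕ) : cc n * cc n * (2 * Real.pi) ^ n = 1 := by
  unfold cc
  rw [← Real.rpow_natCast (2 * Real.pi) n, ← Real.rpow_add (by positivity),
    ← Real.rpow_add (by positivity)]
  rw [show -(n : ℝ) / 2 + -(n : ℝ) / 2 + n = 0 by ring, Real.rpow_zero]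

lemma FT_eq {n : ℕ} (f : EE n → ℂ) (ξ : EE n) :
    FT f ξ = (cc n : ℂ) * 𝓕 f ((2 * Real.pi)⁻¹ • ξ) := by
  unfold FT cc
  rw [Real.fourier_eq']
  congr 2
  ext x
  rw [inner_smul_right, smul_eq_mul, mul_comm]
  congr 2
  push_cast
  field_simp

lemma IFT_eq {n : ℕ} (f : EE n → ℂ) (ξ : EE n) :
    IFT f ξ = (cc n : ℂ) * 𝓕⁻ f ((2 * Real.pi)⁻¹ • ξ) := by
  unfold IFT cc
  rw [Real.fourierInv_eq']
  congr 2
  ext x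
  rw [inner_smul_right, smul_eq_mul, mul_comm, real_inner_comm]
  congr 2
  push_cast
  field_simp

/-- Dilation by `(2π)⁻¹`. -/
def dil (n : ℕ) : EE n ≃L[ℝ] EE n :=
  ContinuousLinearEquiv.smulLeft (Units.mk0 ((2 * Real.pi)⁻¹ : ℝ) (by positivity))

lemma dil_apply {n : ℕ} (x : EE n) : dil n x = (2 * Real.pi)⁻¹ • x := rfl

lemma FT_schwartz {n : ℕ} (f : 𝓢(EE n, ℂ)) : ∃ g : 𝓢(EE n, ℂ), ⇑g = FT (⇑f) := by
  refine ⟨(cc n : ℂ) • SchwartzMap.compCLMOfContinuousLinearEquiv ℂ (dil n) (𝓕 f), ?_⟩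
  ext ξ
  rw [FT_eq, ← SchwartzMap.fourier_coe]
  rfl

lemma IFT_schwartz {n : ℕ} (f : 𝓢(EE n, ℂ)) : ∃ g : 𝓢(EE n, ℂ), ⇑g = IFT (⇑f) := by
  refine ⟨(cc n : ℂ) • SchwartzMap.compCLMOfContinuousLinearEquiv ℂ (dil n) (𝓕⁻ f), ?_⟩
  ext ξ
  rw [IFT_eq, ← SchwartzMap.fourierInv_coe]
  rfl

lemma fourierInv_dil {n : ℕ} (g : EE n → ℂ) (x : EE n) :
    𝓕⁻ (fun ξ => g ((2 * Real.pi)⁻¹ • ξ)) ((2 * Real.pi)⁻¹ • x)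
      = ((2 * Real.pi) ^ n : ℝ) * 𝓕⁻ g x := by
  rw [Real.fourierInv_eq', Real.fourierInv_eq']
  have := Measure.integral_comp_inv_smul_of_nonneg (volume : Measure (EE n))
    (fun v => Complex.exp ((↑(2 * Real.pi * ⟪v, x⟫) * Complex.I)) • g v)
    (R := 2 * Real.pi) (by positivity)
  rw [finrank_euclideanSpace_fin, Complex.real_smul] at this
  rw [← this]
  congr 1
  ext v
  rw [inner_smul_left, inner_smul_right]
  rfl

lemma fourier_dil {n : ℕ} (g : EE n → ℂ) (x : EE n) :
    𝓕 (fun ξ => g ((2 * Real.pi)⁻¹ • ξ)) ((2 * Real.pi)⁻¹ • x)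
      = ((2 * Real.pi) ^ n : ℝ) * 𝓕 g x := by
  have h := fourierInv_dil g (-x)
  rw [Real.fourierInv_eq_fourier_neg, Real.fourierInv_eq_fourier_neg, smul_neg, neg_neg, neg_neg]
    at h
  exact h

lemma fourierInv_cmul {n : ℕ} (c : ℂ) (g : EE n → ℂ) (x : EE n) :
    𝓕⁻ (fun ξ => c * g ξ) x = c * 𝓕⁻ g x := by
  rw [Real.fourierInv_eq', Real.fourierInv_eq', ← integral_const_mul]
  congr 1
  ext v
  simp only [smul_eq_mul]; ring

lemma fourier_cmul {n : ℕ} (c : ℂ) (g : EE n → ℂ) (x : EE n) :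
    𝓕 (fun ξ => c * g ξ) x = c * 𝓕 g x := by
  rw [Real.fourier_eq', Real.fourier_eq', ← integral_const_mul]
  congr 1
  ext v
  simp only [smul_eq_mul]; ring

lemma cc_sq' (n : ℕ) : (cc n : ℂ) * ((cc n : ℂ) * ((2 * Real.pi) ^ n : ℝ)) = 1 := by
  rw [← mul_assoc]; exact_mod_cast cc_sq n

lemma IFT_FT {n : ℕ} (f : 𝓢(EE n, ℂ)) (x : EE n) : IFT (FT (⇑f)) x = f x := by
  rw [IFT_eq, show FT (⇑f) = fun ξ => (cc n : ℂ) * 𝓕 (⇑f) ((2 * Real.pi)⁻¹ • ξ) from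
    funext fun ξ => FT_eq _ ξ, fourierInv_cmul, fourierInv_dil, ← mul_assoc, ← mul_assoc,
    mul_assoc (cc n : ℂ), cc_sq', one_mul, ← SchwartzMap.fourier_coe, ← SchwartzMap.fourierInv_coe]
  rw [FourierTransform.fourierInv_fourier_eq]

lemma FT_IFT {n : ℕ} (f : 𝓢(EE n, ℂ)) (x : EE n) : FT (IFT (⇑f)) x = f x := by
  rw [FT_eq, show IFT (⇑f) = fun ξ => (cc n : ℂ) * 𝓕⁻ (⇑f) ((2 * Real.pi)⁻¹ • ξ) from
    funext fun ξ => IFT_eq _ ξ, fourier_cmul, fourier_dil, ← mul_assoc, ← mul_assoc,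
    mul_assoc (cc n : ℂ), cc_sq', one_mul, ← SchwartzMap.fourierInv_coe, ← SchwartzMap.fourier_coe]
  rw [FourierTransform.fourier_fourierInv_eq]

lemma cexp_temperate : Function.HasTemperateGrowth (fun x : ℝ => Complex.exp (Complex.I * x)) := by
  have hd : ∀ k : ℕ, iteratedDeriv k (fun x : ℝ => Complex.exp (Complex.I * x))
      = fun x : ℝ => Complex.I ^ k * Complex.exp (Complex.I * x) := by
    intro k
    induction k with
    | zero => simp
    | succ k ih =>
      rw [iteratedDeriv_succ, ih]
      ext x
      have h1 : HasDerivAt (fun x : ℝ => Complex.I * (x : ℂ)) (Complex.I * 1) x :=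
        (Complex.ofRealCLM.hasDerivAt (x := x)).const_mul Complex.I
      rw [(h1.cexp.const_mul (Complex.I ^ k)).deriv]
      ring
  refine ⟨?_, fun k => ⟨0, 1, fun x => ?_⟩⟩
  · apply Complex.contDiff_exp.comp
    exact contDiff_const.mul Complex.ofRealCLM.contDiff
  · rw [norm_iteratedFDeriv_eq_norm_iteratedDeriv, hd]
    simp [Complex.norm_exp]

lemma mult_temperate {n : ℕ} (t : ℝ) : Function.HasTemperateGrowth
    (fun ξ : EE n => Complex.exp (-Complex.I * (t : ℂ) * (‖ξ‖ : ℂ) ^ 2 / 2)) := by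
  have h : Function.HasTemperateGrowth (fun ξ : EE n => (-t / 2) * ‖ξ‖ ^ 2) :=
    (Function.HasTemperateGrowth.const _).fun_mul (Function.hasTemperateGrowth_norm_sq _)
  convert cexp_temperate.comp h using 1
  ext ξ
  simp only [Function.comp]
  congr 1
  push_cast
  ring

lemma freeProp_schwartz {n : ℕ} (t : ℝ) (f : 𝓢(EE n, ℂ)) :
    ∃ g : 𝓢(EE n, ℂ), ⇑g = freeProp t (⇑f) ∧
      ∀ ξ, FT (⇑g) ξ = Complex.exp (-Complex.I * (t : ℂ) * (‖ξ‖ : ℂ) ^ 2 / 2) * FT (⇑f) ξ := by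
  obtain ⟨F, hF⟩ := FT_schwartz f
  set h := SchwartzMap.smulLeftCLM ℂ
    (fun ξ : EE n => Complex.exp (-Complex.I * (t : ℂ) * (‖ξ‖ : ℂ) ^ 2 / 2)) F with hh
  have e : ⇑h = fun ξ => Complex.exp (-Complex.I * (t : ℂ) * (‖ξ‖ : ℂ) ^ 2 / 2) * FT (⇑f) ξ := by
    ext ξ
    rw [hh, SchwartzMap.smulLeftCLM_apply_apply (mult_temperate t), hF, smul_eq_mul]
  obtain ⟨g, hg⟩ := IFT_schwartz h
  refine ⟨g, ?_, fun ξ => ?_⟩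
  · rw [hg, e]; rfl
  · rw [hg, FT_IFT, e]

lemma FT_prod {n : ℕ} (v V : EE n → ℂ) (hv : Integrable v volume) (hV : ∀ x, V x = IFT v x)
    (g : 𝓢(EE n, ℂ)) (η : EE n) :
    FT (fun y => V y * g y) η = (cc n : ℂ) * ∫ ξ, v ξ * FT (⇑g) (η - ξ) := by
  have hint : Integrable (Function.uncurry fun (y ξ : EE n) =>
      v ξ * Complex.exp (Complex.I * ((⟪y, ξ⟫ : ℝ) : ℂ)) * g y *
        Complex.exp (-Complex.I * ((⟪y, η⟫ : ℝ) : ℂ))) (volume.prod volume) := by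
    have h0 : Integrable (fun z : EE n × EE n => g z.1 * v z.2) (volume.prod volume) :=
      g.integrable.mul_prod hv
    have hc : Continuous fun z : EE n × EE n =>
        Complex.exp (Complex.I * ((⟪z.1, z.2⟫ - ⟪z.1, η⟫ : ℝ) : ℂ)) := by fun_prop
    refine (h0.bdd_mul (c := 1) hc.aestronglyMeasurable ?_).congr ?_
    · refine Eventually.of_forall fun z => ?_
      rw [mul_comm, Complex.norm_exp_ofReal_mul_I]
    · refine Eventually.of_forall fun z => ?_
      simp only [Function.uncurry]
      push_cast
      rw [mul_sub, sub_eq_add_neg, Complex.exp_add, ← neg_mul]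
      ring
  unfold FT
  rw [← cc]
  congr 1
  calc _ = ∫ y, (cc n : ℂ) * ∫ ξ, v ξ * Complex.exp (Complex.I * ((⟪y, ξ⟫ : ℝ) : ℂ)) * g y *
        Complex.exp (-Complex.I * ((⟪y, η⟫ : ℝ) : ℂ)) := by
        congr 1; ext y
        dsimp only
        rw [hV, IFT, ← cc, integral_mul_const, integral_mul_const]
        ring
    _ = (cc n : ℂ) * ∫ ξ, ∫ y, v ξ * Complex.exp (Complex.I * ((⟪y, ξ⟫ : ℝ) : ℂ)) * g y *
        Complex.exp (-Complex.I * ((⟪y, η⟫ : ℝ) : ℂ)) := by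
        rw [integral_const_mul, integral_integral_swap hint]
    _ = _ := by
        rw [← integral_const_mul]
        congr 1; ext ξ
        rw [mul_left_comm]
        congr 1
        rw [← integral_const_mul]
        congr 1; ext y
        rw [inner_sub_right]
        push_cast
        rw [mul_sub, sub_eq_add_neg, Complex.exp_add]
        simp only [neg_mul, neg_neg]
        ring

lemma main_formula {n : ℕ} (s : ℝ) (f : 𝓢(EE n, ℂ)) (v V : EE n → ℂ)
    (hv : Integrable v volume) (hV : ∀ x, V x = IFT v x) (x : EE n) :
    freeProp s (fun y => V y * freeProp (-s) (⇑f) y) x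
      = (cc n : ℂ) * ∫ ξ, v ξ * Complex.exp (Complex.I * ((⟪x, ξ⟫ : ℝ) : ℂ)
              - Complex.I * (s : ℂ) * (‖ξ‖ : ℂ) ^ 2 / 2) * f (x - s • ξ) := by
  obtain ⟨g, hg, hFg⟩ := freeProp_schwartz (-s) f
  obtain ⟨G, hG⟩ := FT_schwartz g
  rw [← hg, freeProp, IFT, ← cc]
  simp only [FT_prod v V hv hV g]
  congr 1
  have hint : Integrable (Function.uncurry fun (η ξ : EE n) =>
      v ξ * (FT (⇑g) (η - ξ) * (Complex.exp (-Complex.I * (s : ℂ) * (‖η‖ : ℂ) ^ 2 / 2) *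
        Complex.exp (Complex.I * ((⟪x, η⟫ : ℝ) : ℂ))))) (volume.prod volume) := by
    have h0 := hv.convolution_integrand (ContinuousLinearMap.mul ℝ ℂ) G.integrable
      (μ := (volume : Measure (EE n)))
    have hc : Continuous fun z : EE n × EE n =>
        Complex.exp (((-s * ‖z.1‖ ^ 2 / 2 + ⟪x, z.1⟫ : ℝ) : ℂ) * Complex.I) := by fun_prop
    refine (h0.bdd_mul (c := 1) hc.aestronglyMeasurable ?_).congr ?_
    · refine Eventually.of_forall fun z => ?_
      rw [Complex.norm_exp_ofReal_mul_I]
    · refine Eventually.of_forall fun z => ?_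
      simp only [Function.uncurry, ContinuousLinearMap.mul_apply', hG]
      rw [← Complex.exp_add]
      push_cast
      rw [show (-(s : ℂ) * (‖z.1‖ : ℂ) ^ 2 / 2 + ((⟪x, z.1⟫ : ℝ) : ℂ)) * Complex.I
        = -Complex.I * (s : ℂ) * (‖z.1‖ : ℂ) ^ 2 / 2 + Complex.I * ((⟪x, z.1⟫ : ℝ) : ℂ) by ring]
      ring
  calc _ = ∫ η, (cc n : ℂ) * ∫ ξ, v ξ * (FT (⇑g) (η - ξ) *
        (Complex.exp (-Complex.I * (s : ℂ) * (‖η‖ : ℂ) ^ 2 / 2) *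
        Complex.exp (Complex.I * ((⟪x, η⟫ : ℝ) : ℂ)))) := by
        congr 1; ext η
        simp only [← mul_assoc]
        rw [integral_mul_const, integral_mul_const]
        ring
    _ = (cc n : ℂ) * ∫ ξ, ∫ η, v ξ * (FT (⇑g) (η - ξ) *
        (Complex.exp (-Complex.I * (s : ℂ) * (‖η‖ : ℂ) ^ 2 / 2) *
        Complex.exp (Complex.I * ((⟪x, η⟫ : ℝ) : ℂ)))) := by
        rw [integral_const_mul, integral_integral_swap hint]
    _ = _ := by
        rw [← integral_const_mul]
        congr 1; ext ξ
        rw [integral_const_mul, mul_left_comm, mul_assoc]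
        congr 1
        rw [← IFT_FT f (x - s • ξ), IFT, ← cc, mul_left_comm]
        congr 1
        rw [← integral_add_right_eq_self _ ξ, ← integral_const_mul]
        congr 1; ext η
        rw [add_sub_cancel_right, hFg]
        have e1 : ((‖η + ξ‖ : ℝ) : ℂ) ^ 2 =
            (‖η‖ : ℂ) ^ 2 + 2 * ((⟪ξ, η⟫ : ℝ) : ℂ) + (‖ξ‖ : ℂ) ^ 2 := by
          rw [real_inner_comm]
          exact_mod_cast norm_add_sq_real η ξ
        rw [e1, inner_add_right, inner_sub_left, real_inner_smul_left]
        rw [mul_comm (Complex.exp _) (FT (⇑f) η), mul_assoc, ← mul_assoc (Complex.exp _) (FT _ _),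
          mul_comm (Complex.exp _) (FT (⇑f) η), mul_assoc, ← Complex.exp_add, ← Complex.exp_add,
          mul_assoc (FT (⇑f) η), ← Complex.exp_add]
        congr 2
        push_cast
        ring

lemma jensen_aux {α : Type*} [MeasurableSpace α] (μ : Measure α) {p : ℝ} (hp : 1 ≤ p)
    (a b : α → ℝ≥0∞) (ha : AEMeasurable a μ) (hb : AEMeasurable b μ) :
    (∫⁻ t, a t * b t ∂μ) ^ p ≤ (∫⁻ t, a t ∂μ) ^ (p - 1) * ∫⁻ t, a t * b t ^ p ∂μ := by
  rcases hp.eq_or_lt with rfl | hp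
  · simp
  have hpq := Real.HolderConjugate.conjExponent hp
  set q := p.conjExponent
  have hp0 : 0 < p := hpq.pos
  have hq0 : 0 < q := hpq.symm.pos
  have H := ENNReal.lintegral_mul_le_Lp_mul_Lq μ hpq.symm
    (f := fun t => a t ^ (1 / q)) (g := fun t => a t ^ (1 / p) * b t)
    (ha.pow_const _) ((ha.pow_const _).mul hb)
  have e1 : ∀ t, ((fun t => a t ^ (1 / q)) * fun t => a t ^ (1 / p) * b t) t = a t * b t := by
    intro t
    simp only [Pi.mul_apply]
    rw [← mul_assoc, ← ENNReal.rpow_add_of_nonneg _ _ (by positivity) (by positivity)]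
    rw [show 1 / q + 1 / p = 1 by simpa using hpq.symm.inv_add_inv_eq_one, ENNReal.rpow_one]
  simp only [e1] at H
  have e2 : ∀ t, (a t ^ (1 / q)) ^ q = a t := by
    intro t; rw [← ENNReal.rpow_mul, one_div_mul_cancel hq0.ne', ENNReal.rpow_one]
  have e3 : ∀ t, (a t ^ (1 / p) * b t) ^ p = a t * b t ^ p := by
    intro t
    rw [ENNReal.mul_rpow_of_nonneg _ _ hp0.le, ← ENNReal.rpow_mul, one_div_mul_cancel hp0.ne',
      ENNReal.rpow_one]
  simp only [e2, e3] at H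
  refine (ENNReal.rpow_le_rpow H hp0.le).trans_eq ?_
  rw [ENNReal.mul_rpow_of_nonneg _ _ hp0.le, ← ENNReal.rpow_mul, ← ENNReal.rpow_mul,
    one_div_mul_cancel hp0.ne', ENNReal.rpow_one]
  congr 2
  have := hpq.symm.inv_add_inv_eq_one
  have h2 : q⁻¹ = 1 - p⁻¹ := by linarith
  rw [one_div, h2]
  field_simp

lemma main_bound {n : ℕ} (s c : ℝ) (f : 𝓢(EE n, ℂ)) (v : EE n → ℂ)
    (hv : Integrable v volume) (F : EE n → ℂ)
    (hF : ∀ x, ‖F x‖ₑ ≤ ENNReal.ofReal c * ∫⁻ ξ, ‖v ξ‖ₑ * ‖f (x - s • ξ)‖ₑ)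
    (p : ℝ≥0∞) (hp : 1 ≤ p) :
    eLpNorm F p volume ≤ ENNReal.ofReal c * eLpNorm v 1 volume * eLpNorm (⇑f) p volume := by
  have hvm : AEMeasurable (fun ξ => ‖v ξ‖ₑ) volume := hv.1.enorm
  have hfc : Continuous fun x => ‖f x‖ₑ := f.continuous.enorm
  rw [eLpNorm_one_eq_lintegral_enorm]
  rcases eq_or_ne p ⊤ with rfl | hpt
  · have hb : ∀ y, ‖f y‖ₑ ≤ eLpNorm (⇑f) ⊤ volume := by
      intro y
      by_contra! hy
      have ho : IsOpen {y | eLpNorm (⇑f) ⊤ volume < ‖f y‖ₑ} := isOpen_lt continuous_const hfc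
      have h0 := (ho.measure_pos volume ⟨y, hy⟩).ne'
      apply h0
      rw [eLpNorm_exponent_top]
      exact meas_eLpNormEssSup_lt
    rw [eLpNorm_exponent_top (f := F)]
    refine essSup_le_of_ae_le _ (Eventually.of_forall fun x => (hF x).trans ?_)
    rw [mul_assoc, ← lintegral_mul_const'' _ hvm]
    refine mul_le_mul_right (lintegral_mono fun ξ => ?_) _
    exact mul_le_mul_right (hb _) _
  · have hp0 : p ≠ 0 := (zero_lt_one.trans_le hp).ne'
    have hr : 1 ≤ p.toReal := by
      rw [← ENNReal.toReal_one]; exact ENNReal.toReal_mono hpt hp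
    have hr0 : 0 < p.toReal := by linarith
    rw [eLpNorm_eq_lintegral_rpow_enorm_toReal hp0 hpt,
      eLpNorm_eq_lintegral_rpow_enorm_toReal hp0 hpt]
    set r := p.toReal
    set A := ∫⁻ ξ, ‖v ξ‖ₑ with hA
    set B := ∫⁻ x, ‖f x‖ₑ ^ r with hB
    have key : ∫⁻ x, ‖F x‖ₑ ^ r ≤ (ENNReal.ofReal c * A) ^ r * B := by
      calc ∫⁻ x, ‖F x‖ₑ ^ r
          ≤ ∫⁻ x, (ENNReal.ofReal c) ^ r * (A ^ (r - 1) *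
              ∫⁻ ξ, ‖v ξ‖ₑ * ‖f (x - s • ξ)‖ₑ ^ r) := by
            refine lintegral_mono fun x => ?_
            refine (ENNReal.rpow_le_rpow (hF x) hr0.le).trans ?_
            rw [ENNReal.mul_rpow_of_nonneg _ _ hr0.le]
            gcongr
            refine jensen_aux volume hr _ _ hvm ?_
            exact (hfc.comp (by fun_prop)).measurable.aemeasurable
        _ = (ENNReal.ofReal c) ^ r * (A ^ (r - 1) *
              ∫⁻ x, ∫⁻ ξ, ‖v ξ‖ₑ * ‖f (x - s • ξ)‖ₑ ^ r) := by
            have hAt : A ≠ ⊤ := hv.2.ne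
            rw [lintegral_const_mul' _ _ (by finiteness),
              lintegral_const_mul' _ _ (ENNReal.rpow_ne_top_of_nonneg (by linarith) hAt)]
        _ = (ENNReal.ofReal c) ^ r * (A ^ (r - 1) * (A * B)) := by
            rw [lintegral_lintegral_swap]
            · congr 2
              rw [hA, ← lintegral_mul_const'' _ hvm]
              congr 1; ext ξ
              rw [lintegral_const_mul' _ _ (by simp)]
              rw [lintegral_sub_right_eq_self (fun x => ‖f x‖ₑ ^ r) (s • ξ)]
            · refine (hvm.comp_snd).mul ?_
              refine (Continuous.measurable ?_).aemeasurable.pow_const _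
              exact hfc.comp (by fun_prop)
        _ = _ := by
            rw [ENNReal.mul_rpow_of_nonneg _ _ hr0.le, ← mul_assoc (A ^ (r - 1)), ← mul_assoc]
            congr 2
            nth_rewrite 2 [← ENNReal.rpow_one A]
            rw [← ENNReal.rpow_add_of_nonneg _ _ (by linarith) (by norm_num)]
            congr 1; ring
    refine (ENNReal.rpow_le_rpow key (by positivity)).trans_eq ?_
    rw [ENNReal.mul_rpow_of_nonneg _ _ (by positivity), ← ENNReal.rpow_mul,
      mul_one_div_cancel hr0.ne', ENNReal.rpow_one]

/-- explicit formula and `L^p` bound for `e^{isΔ/2} V e^{−isΔ/2}` where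
`V` is the inverse Fourier transform of `v ∈ L¹`. -/
theorem stmt_14 (n : ℕ) (hn : 1 ≤ n) (s : ℝ) (f : SchwartzMap (EuclideanSpace ℝ (Fin n)) ℂ)
    (v : EuclideanSpace ℝ (Fin n) → ℂ) (hv : Integrable v volume)
    (V : EuclideanSpace ℝ (Fin n) → ℂ)
    (hV : ∀ x, V x = (((2 * Real.pi) ^ (-(n : ℝ) / 2) : ℝ) : ℂ) *
      ∫ ξ, v ξ * Complex.exp (Complex.I * ((⟪x, ξ⟫ : ℝ) : ℂ))) :
    (∀ x, freeProp s (fun y => V y * freeProp (-s) (⇑f) y) x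
        = (((2 * Real.pi) ^ (-(n : ℝ) / 2) : ℝ) : ℂ) *
          ∫ ξ, v ξ * Complex.exp (Complex.I * ((⟪x, ξ⟫ : ℝ) : ℂ)
              - Complex.I * (s : ℂ) * (‖ξ‖ : ℂ) ^ 2 / 2) * f (x - s • ξ)) ∧
    ∀ p : ℝ≥0∞, 1 ≤ p →
      eLpNorm (freeProp s (fun y => V y * freeProp (-s) (⇑f) y)) p volume
        ≤ ENNReal.ofReal ((2 * Real.pi) ^ (-(n : ℝ) / 2)) * eLpNorm v 1 volume
          * eLpNorm (⇑f) p volume := by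
  have hV' : ∀ x, V x = IFT v x := hV
  have hm := main_formula s f v V hv hV'
  refine ⟨hm, fun p hp => ?_⟩
  refine main_bound s _ f v hv _ (fun x => ?_) p hp
  have h0 : ‖(cc n : ℂ)‖ₑ = ENNReal.ofReal (cc n) := by
    rw [← ofReal_norm, Complex.norm_real, Real.norm_of_nonneg (cc_pos n).le]
  rw [hm x, enorm_mul, ← cc, h0]
  gcongr
  refine (enorm_integral_le_lintegral_enorm _).trans (lintegral_mono fun ξ => ?_)
  rw [enorm_mul, enorm_mul]
  have h1 : ‖Complex.exp (Complex.I * ((⟪x, ξ⟫ : ℝ) : ℂ)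
      - Complex.I * (s : ℂ) * (‖ξ‖ : ℂ) ^ 2 / 2)‖ₑ = 1 := by
    rw [show Complex.I * ((⟪x, ξ⟫ : ℝ) : ℂ) - Complex.I * (s : ℂ) * (‖ξ‖ : ℂ) ^ 2 / 2
      = ((⟪x, ξ⟫ - s * ‖ξ‖ ^ 2 / 2 : ℝ) : ℂ) * Complex.I by push_cast; ring,
      ← ofReal_norm, Complex.norm_exp_ofReal_mul_I, ENNReal.ofReal_one]
  rw [h1, mul_one]
end
end

section
/- Let U, W : ℝⁿ → ℝ be bounded continuous functions, α, γ ∈ ℝ, v ∈ ℝⁿ, and set θ(t,x) := (|v|² + α²)t + 2 x·v + γ and ω(t) := α² t + γ. Let ψ₁, ψ₂ : ℝ×ℝⁿ → ℂ be C¹ in t and C² in x and satisfy (1/i)∂_tψ₁ − (1/2)Δψ₁ + U(x−vt)ψ₁ − e^{iθ(t,x−vt)} W(x−vt) ψ₂ = 0 and (1/i)∂_tψ₂ + (1/2)Δψ₂ − U(x−vt)ψ₂ + e^{−iθ(t,x−vt)} W(x−vt) ψ₁ = 0. Define φ₁(t,x) := e^{−iω(t)/2} e^{−i|v|²t/2}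 e^{−i x·v} ψ₁(t, x+tv) and φ₂(t,x) := e^{iω(t)/2} e^{i|v|²t/2} e^{i x·v} ψ₂(t, x+tv). Then (φ₁,φ₂) solves the autonomous system (1/i)∂_tφ₁ + (−(1/2)Δ + α²/2 + U(x))φ₁ − W(x)φ₂ = 0 and (1/i)∂_tφ₂ + W(x)φ₁ + ((1/2)Δ − α²/2 − U(x))φ₂ = 0 pointwise on ℝ×ℝⁿ. -/
open MeasureTheory Filter
open scoped ENNReal RealInnerProductSpace

noncomputable section

/-- The Laplacian of `f` at `x`: the sum of the pure second derivatives. -/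
def lap {n : ℕ} (f : EuclideanSpace ℝ (Fin n) → ℂ) (x : EuclideanSpace ℝ (Fin n)) : ℂ :=
  ∑ i, iteratedFDeriv ℝ 2 f x ![EuclideanSpace.single i 1, EuclideanSpace.single i 1]

lemma aux_fderiv {n : ℕ} (v w : EuclideanSpace ℝ (Fin n)) (a c : ℂ)
    (g : EuclideanSpace ℝ (Fin n) → ℂ) (y e : EuclideanSpace ℝ (Fin n))
    (hg : DifferentiableAt ℝ g (y + w)) :
    HasFDerivAt (fun y => c * Complex.exp (a * ((⟪y, v⟫ : ℝ) : ℂ)) * g (y + w))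
      ((c * Complex.exp (a * ((⟪y, v⟫ : ℝ) : ℂ))) • (fderiv ℝ g (y + w)
        + (a * g (y + w)) • (Complex.ofRealCLM.comp (innerSL ℝ v)))) y := by
  have h1 : HasFDerivAt (fun y : EuclideanSpace ℝ (Fin n) => ((⟪y, v⟫ : ℝ) : ℂ))
      (Complex.ofRealCLM.comp (innerSL ℝ v)) y := by
    have := (Complex.ofRealCLM.comp (innerSL ℝ v)).hasFDerivAt (x := y)
    convert this using 2
    simp [real_inner_comm]
  have h2 := ((h1.const_mul a).cexp).const_mul c
  have h3 : HasFDerivAt (fun y => g (y + w)) (fderiv ℝ g (y + w)) y :=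
    by
    have h := HasFDerivAt.comp (g := g) (f := fun y => y + w) y hg.hasFDerivAt
      ((hasFDerivAt_id y).add_const w)
    rw [ContinuousLinearMap.comp_id] at h
    exact h
  refine (h2.mul h3).congr_fderiv ?_
  ext z
  simp
  ring

lemma aux_second {n : ℕ} (v w : EuclideanSpace ℝ (Fin n)) (a c : ℂ)
    (g : EuclideanSpace ℝ (Fin n) → ℂ) (hg : ContDiff ℝ 2 g) (x e : EuclideanSpace ℝ (Fin n)) :
    iteratedFDeriv ℝ 2 (fun y => c * Complex.exp (a * ((⟪y, v⟫ : ℝ) : ℂ)) * g (y + w)) x ![e, e]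
    = (c * Complex.exp (a * ((⟪x, v⟫ : ℝ) : ℂ))) * (iteratedFDeriv ℝ 2 g (x + w) ![e, e]
      + 2 * a * fderiv ℝ g (x + w) (((⟪v, e⟫ : ℝ)) • e)
      + a ^ 2 * ((⟪v, e⟫ ^ 2 : ℝ) : ℂ) * g (x + w)) := by
  have hgd : Differentiable ℝ g := hg.differentiable (by norm_num)
  have hg1 : Differentiable ℝ (fderiv ℝ g) :=
    (hg.fderiv_right (m := 1) (by norm_num)).differentiable (by norm_num)
  have hfd : fderiv ℝ (fun y => c * Complex.exp (a * ((⟪y, v⟫ : ℝ) : ℂ)) * g (y + w)) =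
      fun y => ((c * Complex.exp (a * ((⟪y, v⟫ : ℝ) : ℂ))) • (fderiv ℝ g (y + w)
        + (a * g (y + w)) • (Complex.ofRealCLM.comp (innerSL ℝ v)))) := by
    funext y
    exact (aux_fderiv v w a c g y e (hgd _)).fderiv
  have hf2 : ContDiff ℝ 2 (fun y => c * Complex.exp (a * ((⟪y, v⟫ : ℝ) : ℂ)) * g (y + w)) := by
    have h1 : ContDiff ℝ 2 (fun y : EuclideanSpace ℝ (Fin n) => ((⟪y, v⟫ : ℝ) : ℂ)) :=
      Complex.ofRealCLM.contDiff.comp (contDiff_id.inner ℝ contDiff_const)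
    have h2 : ContDiff ℝ 2 (fun y => g (y + w)) := hg.comp (contDiff_id.add contDiff_const)
    exact (contDiff_const.mul ((contDiff_const.mul h1).cexp)).mul h2
  have hf1 : Differentiable ℝ (fderiv ℝ (fun y => c * Complex.exp (a * ((⟪y, v⟫ : ℝ) : ℂ)) * g (y + w))) :=
    (hf2.fderiv_right (m := 1) (by norm_num)).differentiable (by norm_num)
  rw [iteratedFDeriv_two_apply, iteratedFDeriv_two_apply]
  simp only [Matrix.cons_val_zero, Matrix.cons_val_one]
  have hA : HasFDerivAt (fun y => fderiv ℝ (fun y => c * Complex.exp (a * ((⟪y, v⟫ : ℝ) : ℂ)) * g (y + w)) y e)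
     _ x := (hf1 x).hasFDerivAt.clm_apply (hasFDerivAt_const e x)
  have hh : HasFDerivAt (fun y => fderiv ℝ g y e + (a * g y) * ((⟪v, e⟫ : ℝ) : ℂ)) _ (x + w) :=
    ((hg1 (x + w)).hasFDerivAt.clm_apply (hasFDerivAt_const e (x + w))).add
      (((hgd (x + w)).hasFDerivAt.const_mul a).mul_const (((⟪v, e⟫ : ℝ) : ℂ)))
  have hB := aux_fderiv v w a c (fun y => fderiv ℝ g y e + (a * g y) * ((⟪v, e⟫ : ℝ) : ℂ)) x e
    hh.differentiableAt
  rw [hh.fderiv] at hB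
  have hfun : (fun y => fderiv ℝ (fun y => c * Complex.exp (a * ((⟪y, v⟫ : ℝ) : ℂ)) * g (y + w)) y e)
    = fun y => c * Complex.exp (a * ((⟪y, v⟫ : ℝ) : ℂ)) *
      (fun y => fderiv ℝ g y e + (a * g y) * ((⟪v, e⟫ : ℝ) : ℂ)) (y + w) := by
    funext y
    rw [hfd]
    simp
    ring
  rw [hfun] at hA
  have := DFunLike.congr_fun (hA.unique hB) e
  simp at this
  simp
  rw [this]
  ring

lemma aux_lap {n : ℕ} (v w : EuclideanSpace ℝ (Fin n)) (a c : ℂ)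
    (g : EuclideanSpace ℝ (Fin n) → ℂ) (hg : ContDiff ℝ 2 g) (x : EuclideanSpace ℝ (Fin n)) :
    lap (fun y => c * Complex.exp (a * ((⟪y, v⟫ : ℝ) : ℂ)) * g (y + w)) x
    = (c * Complex.exp (a * ((⟪x, v⟫ : ℝ) : ℂ))) * (lap g (x + w)
      + 2 * a * fderiv ℝ g (x + w) v
      + a ^ 2 * ((‖v‖ ^ 2 : ℝ) : ℂ) * g (x + w)) := by
  have hv : v = ∑ i, (⟪v, EuclideanSpace.single i (1 : ℝ)⟫ : ℝ) • EuclideanSpace.single i (1 : ℝ) := by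
    have := (EuclideanSpace.basisFun (Fin n) ℝ).sum_repr' v
    simp only [EuclideanSpace.basisFun_apply, real_inner_comm] at this
    conv_lhs => rw [← this]
  have hn : ‖v‖ ^ 2 = ∑ i, (⟪v, EuclideanSpace.single i (1 : ℝ)⟫ : ℝ) ^ 2 := by
    rw [EuclideanSpace.norm_sq_eq]
    simp [EuclideanSpace.inner_single_right]
  have hD : fderiv ℝ g (x + w) v = ∑ i, fderiv ℝ g (x + w)
      ((⟪v, EuclideanSpace.single i (1 : ℝ)⟫ : ℝ) • EuclideanSpace.single i (1 : ℝ)) := by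
    rw [← map_sum, ← hv]
  unfold lap
  simp only [aux_second v w a c g hg]
  rw [hD, hn, ← Finset.mul_sum, Finset.sum_add_distrib, Finset.sum_add_distrib,
    Finset.mul_sum, Complex.ofReal_sum, Finset.mul_sum, Finset.sum_mul]

lemma aux_time {n : ℕ} (v x : EuclideanSpace ℝ (Fin n)) (b d k : ℂ)
    (ψ : ℝ → EuclideanSpace ℝ (Fin n) → ℂ) (hψ : Differentiable ℝ (Function.uncurry ψ)) (t : ℝ) :
    deriv (fun s : ℝ => Complex.exp (b * (s : ℂ) + d) * k * ψ s (x + s • v)) t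
    = Complex.exp (b * (t : ℂ) + d) * k * (b * ψ t (x + t • v)
      + deriv (fun s => ψ s (x + t • v)) t + fderiv ℝ (ψ t) (x + t • v) v) := by
  have hF := (hψ (t, x + t • v)).hasFDerivAt
  set F := fderiv ℝ (Function.uncurry ψ) (t, x + t • v) with hFdef
  have h1 : HasDerivAt (fun s => ψ s (x + t • v)) (F (1, 0)) t :=
    HasFDerivAt.comp_hasDerivAt (l := Function.uncurry ψ) (f := fun s : ℝ => (s, x + t • v)) t hF
      ((hasDerivAt_id t).prodMk (hasDerivAt_const t _))
  have h2 : HasFDerivAt (ψ t) (F.comp (ContinuousLinearMap.inr ℝ ℝ _)) (x + t • v) :=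
    HasFDerivAt.comp (g := Function.uncurry ψ) (f := fun y => (t, y)) (x + t • v) hF
      (hasFDerivAt_prodMk_right t _)
  have h3 : HasDerivAt (fun s => ψ s (x + s • v)) (F (1, v)) t := by
    refine HasFDerivAt.comp_hasDerivAt (l := Function.uncurry ψ) (f := fun s : ℝ => (s, x + s • v)) t hF
      ((hasDerivAt_id t).prodMk ?_)
    simpa using ((hasDerivAt_id t).smul_const v).const_add x
  have h4 : HasDerivAt (fun s : ℝ => Complex.exp (b * (s : ℂ) + d) * k)
      (Complex.exp (b * (t : ℂ) + d) * b * k) t := by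
    have : HasDerivAt (fun s : ℝ => b * (s : ℂ) + d) b t := by
      simpa using ((Complex.ofRealCLM.hasDerivAt (x := t)).const_mul b).add_const d
    exact this.cexp.mul_const k
  have h5 : HasDerivAt (fun s : ℝ => Complex.exp (b * (s : ℂ) + d) * k * ψ s (x + s • v)) _ t :=
    h4.mul h3
  rw [h5.deriv, h1.deriv, h2.fderiv]
  have : F (1, v) = F (1, 0) + F (0, v) := by rw [← map_add]; simp
  rw [this]
  simp
  ring

/-- the Galilei transform together with the modulation
`ℳ(t) = diag(e^{−iω(t)/2}, e^{iω(t)/2})`, `ω(t) = α²t + γ`, turns a solution of the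
moving, modulated matrix Schrödinger system into a solution of the autonomous system. -/
theorem stmt_17 (n : ℕ) (U W : EuclideanSpace ℝ (Fin n) → ℝ)
    (hUb : ∃ C, ∀ x, |U x| ≤ C) (hWb : ∃ C, ∀ x, |W x| ≤ C)
    (hUc : Continuous U) (hWc : Continuous W)
    (α γ : ℝ) (v : EuclideanSpace ℝ (Fin n))
    (θ : ℝ → EuclideanSpace ℝ (Fin n) → ℝ)
    (hθ : ∀ t x, θ t x = (‖v‖ ^ 2 + α ^ 2) * t + 2 * ⟪x, v⟫ + γ)
    (ω : ℝ → ℝ) (hω : ∀ t, ω t = α ^ 2 * t + γ)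
    (ψ₁ ψ₂ : ℝ → EuclideanSpace ℝ (Fin n) → ℂ)
    -- regularity: (jointly) C¹ in t and C² in x
    (hψ₁t : Differentiable ℝ (Function.uncurry ψ₁)) (hψ₂t : Differentiable ℝ (Function.uncurry ψ₂))
    (hψ₁x : ∀ t, ContDiff ℝ 2 (ψ₁ t)) (hψ₂x : ∀ t, ContDiff ℝ 2 (ψ₂ t))
    -- the moving, modulated system
    (heq₁ : ∀ t x, (1 / Complex.I) * deriv (fun s => ψ₁ s x) t
        - (1 / 2 : ℂ) * lap (ψ₁ t) x + (U (x - t • v) : ℂ) * ψ₁ t x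
        - Complex.exp (Complex.I * ((θ t (x - t • v) : ℝ) : ℂ)) * (W (x - t • v) : ℂ) * ψ₂ t x
        = 0)
    (heq₂ : ∀ t x, (1 / Complex.I) * deriv (fun s => ψ₂ s x) t
        + (1 / 2 : ℂ) * lap (ψ₂ t) x - (U (x - t • v) : ℂ) * ψ₂ t x
        + Complex.exp (-Complex.I * ((θ t (x - t • v) : ℝ) : ℂ)) * (W (x - t • v) : ℂ) * ψ₁ t x
        = 0)
    (φ₁ φ₂ : ℝ → EuclideanSpace ℝ (Fin n) → ℂ)
    (hφ₁ : ∀ t x, φ₁ t x = Complex.exp (-Complex.I * ((ω t : ℝ) : ℂ) / 2)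
        * Complex.exp (-Complex.I * ((‖v‖ ^ 2 * t / 2 : ℝ) : ℂ))
        * Complex.exp (-Complex.I * ((⟪x, v⟫ : ℝ) : ℂ)) * ψ₁ t (x + t • v))
    (hφ₂ : ∀ t x, φ₂ t x = Complex.exp (Complex.I * ((ω t : ℝ) : ℂ) / 2)
        * Complex.exp (Complex.I * ((‖v‖ ^ 2 * t / 2 : ℝ) : ℂ))
        * Complex.exp (Complex.I * ((⟪x, v⟫ : ℝ) : ℂ)) * ψ₂ t (x + t • v)) :
    -- the autonomous system
    (∀ t x, (1 / Complex.I) * deriv (fun s => φ₁ s x) t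
        + (-(1 / 2 : ℂ) * lap (φ₁ t) x + ((α ^ 2 / 2 : ℝ) : ℂ) * φ₁ t x
            + (U x : ℂ) * φ₁ t x)
        - (W x : ℂ) * φ₂ t x = 0) ∧
    (∀ t x, (1 / Complex.I) * deriv (fun s => φ₂ s x) t
        + (W x : ℂ) * φ₁ t x
        + ((1 / 2 : ℂ) * lap (φ₂ t) x - ((α ^ 2 / 2 : ℝ) : ℂ) * φ₂ t x
            - (U x : ℂ) * φ₂ t x) = 0) := by
  constructor
  · intro t x
    have e1 : φ₁ t = fun y => Complex.exp (-(Complex.I * ((α ^ 2 + ‖v‖ ^ 2 : ℝ) : ℂ) / 2) * (t : ℂ)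
        + (-(Complex.I * γ / 2))) * Complex.exp (-Complex.I * ((⟪y, v⟫ : ℝ) : ℂ)) * ψ₁ t (y + t • v) := by
      funext y
      rw [hφ₁, hω, ← Complex.exp_add]
      congr 3
      push_cast; ring
    have e2 : (fun s => φ₁ s x) = fun s : ℝ => Complex.exp (-(Complex.I * ((α ^ 2 + ‖v‖ ^ 2 : ℝ) : ℂ) / 2) * (s : ℂ)
        + (-(Complex.I * γ / 2))) * Complex.exp (-Complex.I * ((⟪x, v⟫ : ℝ) : ℂ)) * ψ₁ s (x + s • v) := by
      funext s
      rw [hφ₁, hω, ← Complex.exp_add]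
      congr 3
      push_cast; ring
    have e3 : φ₂ t x = Complex.exp (-(Complex.I * ((α ^ 2 + ‖v‖ ^ 2 : ℝ) : ℂ) / 2) * (t : ℂ)
        + (-(Complex.I * γ / 2))) * Complex.exp (-Complex.I * ((⟪x, v⟫ : ℝ) : ℂ))
        * (Complex.exp (Complex.I * ((θ t x : ℝ) : ℂ)) * ψ₂ t (x + t • v)) := by
      rw [hφ₂, hω, hθ, ← mul_assoc]
      simp only [← Complex.exp_add]
      congr 2
      push_cast; ring
    have h := heq₁ t (x + t • v)
    rw [add_sub_cancel_right] at h
    rw [e2, aux_time v x _ _ _ ψ₁ hψ₁t, e1, aux_lap v (t • v) _ _ _ (hψ₁x t), e3]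
    simp only [Complex.ofReal_add, Complex.ofReal_div, Complex.ofReal_pow, Complex.ofReal_ofNat,
      one_div, Complex.inv_I] at h ⊢
    linear_combination (Complex.exp (-(Complex.I * ((α : ℂ) ^ 2 + (‖v‖ : ℂ) ^ 2) / 2) * (t : ℂ)
        + (-(Complex.I * γ / 2))) * Complex.exp (-Complex.I * ((⟪x, v⟫ : ℝ) : ℂ))) * h
        + (Complex.exp (-(Complex.I * ((α : ℂ) ^ 2 + (‖v‖ : ℂ) ^ 2) / 2) * (t : ℂ)
        + (-(Complex.I * γ / 2))) * Complex.exp (-Complex.I * ((⟪x, v⟫ : ℝ) : ℂ))) * (α : ℂ) ^ 2 / 2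
          * ψ₁ t (x + t • v) * Complex.I_sq
  · intro t x
    have e1 : φ₂ t = fun y => Complex.exp ((Complex.I * ((α ^ 2 + ‖v‖ ^ 2 : ℝ) : ℂ) / 2) * (t : ℂ)
        + ((Complex.I * γ / 2))) * Complex.exp (Complex.I * ((⟪y, v⟫ : ℝ) : ℂ)) * ψ₂ t (y + t • v) := by
      funext y
      rw [hφ₂, hω, ← Complex.exp_add]
      congr 3
      push_cast; ring
    have e2 : (fun s => φ₂ s x) = fun s : ℝ => Complex.exp ((Complex.I * ((α ^ 2 + ‖v‖ ^ 2 : ℝ) : ℂ) / 2) * (s : ℂ)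
        + ((Complex.I * γ / 2))) * Complex.exp (Complex.I * ((⟪x, v⟫ : ℝ) : ℂ)) * ψ₂ s (x + s • v) := by
      funext s
      rw [hφ₂, hω, ← Complex.exp_add]
      congr 3
      push_cast; ring
    have e3 : φ₁ t x = Complex.exp ((Complex.I * ((α ^ 2 + ‖v‖ ^ 2 : ℝ) : ℂ) / 2) * (t : ℂ)
        + ((Complex.I * γ / 2))) * Complex.exp (Complex.I * ((⟪x, v⟫ : ℝ) : ℂ))
        * (Complex.exp (-Complex.I * ((θ t x : ℝ) : ℂ)) * ψ₁ t (x + t • v)) := by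
      rw [hφ₁, hω, hθ, ← mul_assoc]
      simp only [← Complex.exp_add]
      congr 2
      push_cast; ring
    have h := heq₂ t (x + t • v)
    rw [add_sub_cancel_right] at h
    rw [e2, aux_time v x _ _ _ ψ₂ hψ₂t, e1, aux_lap v (t • v) _ _ _ (hψ₂x t), e3]
    simp only [Complex.ofReal_add, Complex.ofReal_div, Complex.ofReal_pow, Complex.ofReal_ofNat,
      one_div, Complex.inv_I] at h ⊢
    linear_combination (Complex.exp ((Complex.I * ((α : ℂ) ^ 2 + (‖v‖ : ℂ) ^ 2) / 2) * (t : ℂ)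
        + ((Complex.I * γ / 2))) * Complex.exp (Complex.I * ((⟪x, v⟫ : ℝ) : ℂ))) * h
        - (Complex.exp ((Complex.I * ((α : ℂ) ^ 2 + (‖v‖ : ℂ) ^ 2) / 2) * (t : ℂ)
        + ((Complex.I * γ / 2))) * Complex.exp (Complex.I * ((⟪x, v⟫ : ℝ) : ℂ))) * (α : ℂ) ^ 2 / 2
          * ψ₂ t (x + t • v) * Complex.I_sq
end
end
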